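/- Let Φ(y) = y + Ψ(y) be a diffeomorphism of ℝ² with det(I + ∇Ψ) = 1, and let 0 < s < 1. Then for any u ∈ Ḣ^s(ℝ²), ‖u ∘ Φ‖_{Ḣ^s} ≲ (1 + ‖∇Ψ‖_{L^∞})^{s+1} ‖u‖_{Ḣ^s}. -/

import Mathlib

open MeasureTheory Real FourierTransform ENNReal

noncomputable section

abbrev E2 := EuclideanSpace ℝ (Fin 2)

/-- Homogeneous Sobolev `Ḣˢ(ℝ²)` (semi)norm via the Fourier transform. -/
def hsNorm (s : ℝ) (u : E2 → ℂ) : ℝ≥0∞ :=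
  (∫⁻ ξ : E2, ((‖ξ‖₊ : ℝ≥0∞) ^ (2 * s)) * ((‖𝓕 u ξ‖₊ : ℝ≥0∞) ^ (2 : ℝ))) ^ ((1 : ℝ) / 2)

section Aux

open scoped SchwartzMap ContDiff

lemma integral_schwartz_fourier (f : E2 → ℂ) (hf : Integrable f) (g : 𝓢(E2, ℂ)) :
    ∫ x, (𝓕 g) x • f x = ∫ x, g x • 𝓕 f x := by
  have := (VectorFourier.integral_fourierIntegral_smul_eq_flip (L := innerₗ E2)
      Real.continuous_fourierChar continuous_inner (g.integrable (μ := volume)) hf)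
  simpa [SchwartzMap.fourier_coe] using! this

lemma continuous_fourier_E2 {f : E2 → ℂ} (hf : Integrable f) : Continuous (𝓕 f) :=
  VectorFourier.fourierIntegral_continuous (L := innerₗ E2)
      Real.continuous_fourierChar continuous_inner hf

lemma ae_eq_of_schwartz {f f' : E2 → ℂ} (hf : LocallyIntegrable f) (hf' : LocallyIntegrable f')
    (h : ∀ g : 𝓢(E2, ℂ), ∫ x, g x • f x = ∫ x, g x • f' x) : f =ᵐ[volume] f' := by
  apply ae_eq_of_integral_contDiff_smul_eq hf hf'
  intro g g_smooth g_cpt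
  have hg₁ : HasCompactSupport (Complex.ofRealCLM ∘ g) := g_cpt.comp_left rfl
  have hg₂ : ContDiff ℝ ∞ (Complex.ofRealCLM ∘ g) := by fun_prop
  simpa using h (hg₁.toSchwartzMap hg₂)

lemma plancherel_aux1 {f : E2 → ℂ} (hf : Integrable f) (F : Lp (α := E2) ℂ 2)
    (h : F =ᵐ[volume] f) : (𝓕 F : Lp (α := E2) ℂ 2) =ᵐ[volume] 𝓕 f := by
  apply ae_eq_of_schwartz ((Lp.memLp _).locallyIntegrable (by norm_num))
    (continuous_fourier_E2 hf).locallyIntegrable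
  intro g
  rw [← integral_schwartz_fourier f hf, ← Lp.toTemperedDistribution_apply,
    ← Lp.fourier_toTemperedDistribution_eq, TemperedDistribution.fourier_apply,
    Lp.toTemperedDistribution_apply]
  apply integral_congr_ae
  filter_upwards [h] with x hx
  rw [hx]

lemma plancherel_aux2 {f : E2 → ℂ} (hf : Integrable f) (H : Lp (α := E2) ℂ 2)
    (h : H =ᵐ[volume] 𝓕 f) : (𝓕⁻ H : Lp (α := E2) ℂ 2) =ᵐ[volume] f := by
  apply ae_eq_of_schwartz ((Lp.memLp _).locallyIntegrable (by norm_num))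
    hf.locallyIntegrable
  intro g
  have : ∫ x, g x • f x = ∫ x, (𝓕⁻ g) x • 𝓕 f x := by
    rw [← integral_schwartz_fourier f hf, FourierTransform.fourier_fourierInv_eq]
  rw [this, ← Lp.toTemperedDistribution_apply,
    ← Lp.fourierInv_toTemperedDistribution_eq, TemperedDistribution.fourierInv_apply,
    Lp.toTemperedDistribution_apply]
  apply integral_congr_ae
  filter_upwards [h] with x hx
  rw [hx]

lemma plancherel_L1 {f : E2 → ℂ} (hf : Integrable f) :
    eLpNorm (𝓕 f) 2 volume = eLpNorm f 2 volume := by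
  by_cases h1 : MemLp f 2 volume
  · have := plancherel_aux1 hf h1.toLp h1.coeFn_toLp
    rw [← eLpNorm_congr_ae this, ← eLpNorm_congr_ae h1.coeFn_toLp, ← Lp.enorm_def, ← Lp.enorm_def,
      ← ofReal_norm, ← ofReal_norm, Lp.norm_fourier_eq]
  by_cases h2 : MemLp (𝓕 f) 2 volume
  · have := plancherel_aux2 hf h2.toLp h2.coeFn_toLp
    rw [← eLpNorm_congr_ae this, ← eLpNorm_congr_ae h2.coeFn_toLp, ← Lp.enorm_def, ← Lp.enorm_def,
      ← ofReal_norm, ← ofReal_norm, ← Lp.norm_fourier_eq (𝓕⁻ _),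
      FourierTransform.fourier_fourierInv_eq]
  · have a1 : eLpNorm f 2 volume = ⊤ := by
      by_contra h; exact h1 ⟨hf.1, lt_top_iff_ne_top.2 h⟩
    have a2 : eLpNorm (𝓕 f) 2 volume = ⊤ := by
      by_contra h
      exact h2 ⟨(continuous_fourier_E2 hf).aestronglyMeasurable, lt_top_iff_ne_top.2 h⟩
    rw [a1, a2]

lemma plancherel_lint {f : E2 → ℂ} (hf : Integrable f) :
    ∫⁻ ξ, (‖𝓕 f ξ‖₊ : ℝ≥0∞) ^ (2 : ℝ) = ∫⁻ x, (‖f x‖₊ : ℝ≥0∞) ^ (2 : ℝ) := by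
  have := plancherel_L1 hf
  rw [eLpNorm_eq_lintegral_rpow_enorm_toReal (by norm_num) (by norm_num),
    eLpNorm_eq_lintegral_rpow_enorm_toReal (by norm_num) (by norm_num)] at this
  simpa [enorm_eq_nnnorm] using ENNReal.rpow_left_injective (by norm_num) this

/-- Fourier transform of a difference -/
lemma fourier_diff {u : E2 → ℂ} (hu : Integrable u) (h ξ : E2) :
    𝓕 (fun x => u (x + h) - u x) ξ = ((𝐞 (inner ℝ h ξ) : ℂ) - 1) * 𝓕 u ξ := by
  have h1 := congrFun (VectorFourier.fourierIntegral_comp_add_right 𝐞 volume (innerₗ E2) u h) ξ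
  have h2 : 𝓕 (fun x => u (x + h) - u x) ξ = 𝓕 (fun x => u (x + h)) ξ - 𝓕 u ξ := by
    simp only [Real.fourier_eq]
    rw [← integral_sub]
    · congr 1 with x
      rw [smul_sub]
    · exact (Real.fourierIntegral_convergent_iff ξ).2 (hu.comp_add_right h)
    · exact (Real.fourierIntegral_convergent_iff ξ).2 hu
  rw [h2]
  have h3 : 𝓕 (fun x => u (x + h)) ξ = (𝐞 (inner ℝ h ξ) : ℂ) * 𝓕 u ξ := h1
  rw [h3]; ring

/-- The integrand defining the Gagliardo constant. -/
def gagKer (s : ℝ) (ξ h : E2) : ℝ≥0∞ :=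
  (‖(𝐞 (inner ℝ h ξ) : ℂ) - 1‖₊ : ℝ≥0∞) ^ (2 : ℝ) * (‖h‖₊ : ℝ≥0∞) ^ (-(2 + 2 * s))

lemma measurable_char_E2 : Measurable (fun p : E2 × E2 => ((𝐞 (inner ℝ p.1 p.2) : ℂ) - 1)) := by
  apply Continuous.measurable
  apply Continuous.sub _ continuous_const
  exact continuous_subtype_val.comp (Real.continuous_fourierChar.comp continuous_inner)

lemma measurable_gagKer (s : ℝ) : Measurable (fun p : E2 × E2 => gagKer s p.2 p.1) := by
  unfold gagKer
  have := measurable_char_E2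
  fun_prop

lemma measurable_char_right (ξ : E2) : Measurable (fun h : E2 => ((𝐞 (inner ℝ h ξ) : ℂ) - 1)) := by
  apply Continuous.measurable
  apply Continuous.sub _ continuous_const
  exact continuous_subtype_val.comp
    (Real.continuous_fourierChar.comp (continuous_id.inner continuous_const))

lemma measurable_char_left (h : E2) : Measurable (fun ξ : E2 => ((𝐞 (inner ℝ h ξ) : ℂ) - 1)) := by
  apply Continuous.measurable
  apply Continuous.sub _ continuous_const
  exact continuous_subtype_val.comp
    (Real.continuous_fourierChar.comp (continuous_const.inner continuous_id))

lemma measurable_gagKer_right (s : ℝ) (ξ : E2) : Measurable (gagKer s ξ) := by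
  unfold gagKer
  have := measurable_char_right ξ
  fun_prop

lemma scale_rpow (L : NNReal) (hL : L ≠ 0) (d : ℝ≥0∞) (p : ℝ) (hp : 0 ≤ p) :
    (L : ℝ≥0∞) ^ p * (L * d) ^ (-p) = d ^ (-p) := by
  have h0 : (L : ℝ≥0∞) ^ p ≠ 0 := by
    simp [ENNReal.rpow_eq_zero_iff, hL]
  have h1 : (L : ℝ≥0∞) ^ p ≠ ⊤ := ENNReal.rpow_ne_top_of_nonneg hp ENNReal.coe_ne_top
  rw [ENNReal.rpow_neg, ENNReal.rpow_neg, ENNReal.mul_rpow_of_nonneg _ _ hp,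
    ENNReal.mul_inv (Or.inl h0) (Or.inl h1), ← mul_assoc, ENNReal.mul_inv_cancel h0 h1, one_mul]

lemma gag_scale (s : ℝ) (hs : 0 < s) (e : E2) (he : ‖e‖ = 1) (ξ : E2) :
    ∫⁻ h, gagKer s ξ h = (‖ξ‖₊ : ℝ≥0∞) ^ (2 * s) * ∫⁻ h, gagKer s e h := by
  by_cases h0 : ξ = 0
  · subst h0
    have : (2 * s) > 0 := by linarith
    simp [gagKer, this]
  have hr : 0 < ‖ξ‖ := norm_pos_iff.2 h0
  set r := ‖ξ‖ with hrdef
  obtain ⟨R, hR⟩ : ∃ R : E2 ≃ₗᵢ[ℝ] E2, R (r⁻¹ • ξ) = e := by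
    refine ⟨_, Submodule.reflection_sub ?_⟩
    rw [norm_smul, he, norm_inv, norm_norm, inv_mul_cancel₀ hr.ne']
  have hin (h : E2) : inner ℝ (r • R h) e = inner ℝ h ξ := by
    rw [← hR, real_inner_smul_left, R.inner_map_map, real_inner_smul_right]
    field_simp
  have hpt (h : E2) : gagKer s ξ h =
      (‖ξ‖₊ : ℝ≥0∞) ^ (2 + 2 * s) * gagKer s e (r • R h) := by
    unfold gagKer
    have hrr : (‖r‖₊ : NNReal) = ‖ξ‖₊ := by simp [hrdef]
    rw [hin, nnnorm_smul, R.nnnorm_map, ENNReal.coe_mul, mul_left_comm, hrr,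
      scale_rpow _ (by simpa using h0) _ _ (by linarith)]
  have hm := measurable_gagKer_right s e
  simp_rw [hpt]
  rw [lintegral_const_mul _ (by fun_prop)]
  have h1 : ∫⁻ h, gagKer s e (r • R h) = ∫⁻ h, gagKer s e (r • h) :=
    R.measurePreserving.lintegral_comp (f := fun h => gagKer s e (r • h)) (by fun_prop)
  have h2 : ∫⁻ h, gagKer s e (r • h) = ENNReal.ofReal |(r ^ 2)⁻¹| * ∫⁻ h, gagKer s e h := by
    have := Measure.map_addHaar_smul (volume : Measure E2) hr.ne'
    rw [finrank_euclideanSpace_fin] at this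
    rw [← lintegral_map hm (by fun_prop), this, lintegral_smul_measure, smul_eq_mul]
  rw [h1, h2, ← mul_assoc]
  congr 1
  have h0' : (‖ξ‖₊ : ℝ≥0∞) ≠ 0 := by simpa using h0
  have h3 : ENNReal.ofReal |(r ^ 2)⁻¹| = (‖ξ‖₊ : ℝ≥0∞) ^ (-2 : ℝ) := by
    rw [abs_of_pos (by positivity), ENNReal.ofReal_inv_of_pos (by positivity),
      ENNReal.ofReal_pow hr.le, ENNReal.rpow_neg, ENNReal.rpow_two, hrdef,
      ofReal_norm, enorm_eq_nnnorm]
  rw [h3, ← ENNReal.rpow_add _ _ h0' ENNReal.coe_ne_top]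
  congr 1
  ring

lemma gag_pos (s : ℝ) (e : E2) (he : ‖e‖ = 1) : ∫⁻ h, gagKer s e h ≠ 0 := by
  intro h0
  rw [lintegral_eq_zero_iff (measurable_gagKer_right s e)] at h0
  let U : Set E2 := {h | (𝐞 (inner ℝ h e) : ℂ) - 1 ≠ 0}
  have hU : IsOpen U := by
    apply isOpen_ne.preimage
    apply Continuous.sub _ continuous_const
    exact continuous_subtype_val.comp
      (Real.continuous_fourierChar.comp (continuous_id.inner continuous_const))
  have hU0 : volume U = 0 := by
    refine measure_mono_null ?_ h0
    intro h hh hk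
    simp only [Pi.zero_apply, gagKer] at hk
    rcases mul_eq_zero.1 hk with hk | hk
    · rw [ENNReal.rpow_eq_zero_iff] at hk
      simp [U] at hh hk
      exact hh hk
    · rw [ENNReal.rpow_eq_zero_iff] at hk
      rcases hk with ⟨hk, _⟩ | ⟨hk, _⟩
      · have : h = 0 := by simpa using hk
        subst this
        simp [U] at hh
      · exact ENNReal.coe_ne_top hk
  replace hU0 : U = ∅ := (hU.measure_eq_zero_iff (volume : Measure E2)).1 hU0
  have : (1 / 2 : ℝ) • e ∈ U := by
    have h1 : (2 * π * (1 / 2 : ℝ)) = π := by ring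
    simp only [U, Set.mem_ofPred_eq, real_inner_smul_left, real_inner_self_eq_norm_sq, he,
      Real.fourierChar_apply, one_pow, mul_one, h1, Complex.exp_pi_mul_I]
    norm_num
  rw [hU0] at this
  exact this

lemma gag_fin (s : ℝ) (hs : 0 < s) (hs1 : s < 1) (e : E2) (he : ‖e‖ = 1) :
    ∫⁻ h, gagKer s e h ≠ ⊤ := by
  have hform (h : E2) (h0 : h ≠ 0) : gagKer s e h =
      ENNReal.ofReal (‖(𝐞 (inner ℝ h e) : ℂ) - 1‖ ^ (2:ℝ) * ‖h‖ ^ (-(2 + 2 * s))) := by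
    rw [ENNReal.ofReal_mul (by positivity), ← ENNReal.ofReal_rpow_of_nonneg (by positivity) (by norm_num),
      ← ENNReal.ofReal_rpow_of_pos (by positivity), ofReal_norm, ofReal_norm]
    rfl
  have hb1 (h : E2) : ‖(𝐞 (inner ℝ h e) : ℂ) - 1‖ ≤ 2 * π * ‖h‖ := by
    rw [Real.fourierChar_apply, mul_comm _ Complex.I]
    refine (Real.norm_exp_I_mul_ofReal_sub_one_le).trans ?_
    rw [norm_mul, Real.norm_of_nonneg (by positivity : 0 ≤ 2 * π)]
    gcongr
    simpa [he] using norm_inner_le_norm (𝕜 := ℝ) h e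
  have hb2 (h : E2) : ‖(𝐞 (inner ℝ h e) : ℂ) - 1‖ ≤ 2 := by
    refine (norm_sub_le _ _).trans ?_
    rw [Circle.norm_coe, norm_one]; norm_num
  rw [← lintegral_add_compl _ (Metric.isOpen_ball (x := (0:E2)) (ε := 1)).measurableSet]
  have hae : ∀ᵐ h : E2, h ≠ 0 := by
    simp [ae_iff]
  refine ENNReal.add_ne_top.2 ⟨?_, ?_⟩
  · have hint : IntegrableOn (fun h : E2 => (2 * π) ^ 2 * ‖h‖ ^ (-(2 * s))) (Metric.ball 0 1) := by
      refine integrableOn_ball_of_norm_le_rpow (C := (2 * π) ^ 2) (α := 2 * s) ?_ ?_ ?_ ?_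
      · simp
      · rw [finrank_euclideanSpace_fin]; push_cast; linarith
      · refine Filter.Eventually.of_forall fun x => ?_
        rw [Real.norm_of_nonneg (by positivity)]
      · apply Measurable.aestronglyMeasurable
        fun_prop
    refine ne_top_of_le_ne_top hint.lintegral_lt_top.ne ?_
    apply lintegral_mono_ae
    filter_upwards [ae_restrict_of_ae hae] with h h0
    rw [hform h h0]
    have hp : 0 < ‖h‖ := norm_pos_iff.2 h0
    apply ENNReal.ofReal_le_ofReal
    calc _ ≤ (2 * π * ‖h‖) ^ (2:ℝ) * ‖h‖ ^ (-(2 + 2 * s)) := by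
          gcongr; exact hb1 h
      _ = _ := by
        rw [Real.mul_rpow (by positivity) hp.le, mul_assoc, ← Real.rpow_add hp, Real.rpow_two]
        congr 2
        ring
  · have hint : Integrable (fun h : E2 => (2 ^ (2:ℝ) * 2 ^ (2 + 2 * s)) *
        (1 + ‖h‖) ^ (-(2 + 2 * s))) := by
      apply Integrable.const_mul
      apply integrable_one_add_norm
      simp; linarith
    refine ne_top_of_le_ne_top hint.lintegral_lt_top.ne ?_
    refine le_trans ?_ (setLIntegral_le_lintegral (Metric.ball (0:E2) 1)ᶜ _)
    apply setLIntegral_mono_ae (by fun_prop)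
    filter_upwards [hae] with h h0 hball
    rw [hform h h0]
    have hp : 0 < ‖h‖ := norm_pos_iff.2 h0
    have h1 : 1 ≤ ‖h‖ := by simpa using hball
    apply ENNReal.ofReal_le_ofReal
    rw [mul_assoc]
    gcongr
    · exact hb2 h
    calc ‖h‖ ^ (-(2 + 2 * s)) ≤ ((1 + ‖h‖) / 2) ^ (-(2 + 2 * s)) := by
          apply Real.rpow_le_rpow_of_nonpos (by positivity) <;> linarith
      _ = _ := by
          rw [Real.div_rpow (by positivity) (by norm_num), Real.rpow_neg (by norm_num : (0:ℝ) ≤ 2),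
            div_inv_eq_mul, mul_comm]

/-- Gagliardo double integral. -/
def gag (s : ℝ) (u : E2 → ℂ) : ℝ≥0∞ :=
  ∫⁻ x : E2, ∫⁻ y : E2, (‖u y - u x‖₊ : ℝ≥0∞) ^ (2 : ℝ) * (‖y - x‖₊ : ℝ≥0∞) ^ (-(2 + 2 * s))

lemma gag_eq (s : ℝ) (hs : 0 < s) (e : E2) (he : ‖e‖ = 1) {u : E2 → ℂ} (hm : Measurable u)
    (hu : Integrable u) :
    gag s u = (∫⁻ h, gagKer s e h) *
      ∫⁻ ξ : E2, ((‖ξ‖₊ : ℝ≥0∞) ^ (2 * s)) * ((‖𝓕 u ξ‖₊ : ℝ≥0∞) ^ (2 : ℝ)) := by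
  have hF := (continuous_fourier_E2 hu).measurable
  have hK := measurable_gagKer s
  calc gag s u = ∫⁻ x : E2, ∫⁻ h : E2,
        (‖u (x + h) - u x‖₊ : ℝ≥0∞) ^ (2 : ℝ) * (‖h‖₊ : ℝ≥0∞) ^ (-(2 + 2 * s)) := by
        unfold gag
        congr 1 with x
        rw [← lintegral_add_left_eq_self _ x]
        simp
    _ = ∫⁻ h : E2, ∫⁻ x : E2,
        (‖u (x + h) - u x‖₊ : ℝ≥0∞) ^ (2 : ℝ) * (‖h‖₊ : ℝ≥0∞) ^ (-(2 + 2 * s)) := by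
        apply lintegral_lintegral_swap
        apply Measurable.aemeasurable
        unfold Function.uncurry
        fun_prop
    _ = ∫⁻ h : E2, ∫⁻ ξ : E2, gagKer s ξ h * (‖𝓕 u ξ‖₊ : ℝ≥0∞) ^ (2 : ℝ) := by
        congr 1 with h
        rw [lintegral_mul_const _ (by fun_prop),
          ← plancherel_lint (f := fun x => u (x + h) - u x) ((hu.comp_add_right h).sub hu)]
        rw [← lintegral_mul_const]
        · congr 1 with ξ
          rw [fourier_diff hu, nnnorm_mul, ENNReal.coe_mul,
            ENNReal.mul_rpow_of_nonneg _ _ (by norm_num), gagKer]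
          ring
        · simp_rw [fourier_diff hu]
          have := measurable_char_left h
          fun_prop
    _ = ∫⁻ ξ : E2, ∫⁻ h : E2, gagKer s ξ h * (‖𝓕 u ξ‖₊ : ℝ≥0∞) ^ (2 : ℝ) := by
        apply lintegral_lintegral_swap
        apply Measurable.aemeasurable
        unfold Function.uncurry
        fun_prop
    _ = ∫⁻ ξ : E2, (∫⁻ h, gagKer s e h) *
        (((‖ξ‖₊ : ℝ≥0∞) ^ (2 * s)) * ((‖𝓕 u ξ‖₊ : ℝ≥0∞) ^ (2 : ℝ))) := by
        congr 1 with ξ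
        rw [lintegral_mul_const _ (measurable_gagKer_right s ξ), gag_scale s hs e he]
        ring
    _ = _ := by
        rw [lintegral_const_mul _ (by fun_prop)]

lemma gag_comp_le (s : ℝ) (hs : 0 < s) (Φ : E2 → E2) (L : NNReal) (hL : LipschitzWith L Φ)
    (hL0 : L ≠ 0)
    (hΦ : MeasurePreserving Φ) (u : E2 → ℂ) (hu : Measurable u) :
    gag s (u ∘ Φ) ≤ (L : ℝ≥0∞) ^ (2 + 2 * s) * gag s u := by
  have hc := hL.continuous.measurable
  have hpos : 0 ≤ 2 + 2 * s := by linarith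
  have key (x y : E2) : (‖y - x‖₊ : ℝ≥0∞) ^ (-(2 + 2 * s)) ≤
      (L : ℝ≥0∞) ^ (2 + 2 * s) * (‖Φ y - Φ x‖₊ : ℝ≥0∞) ^ (-(2 + 2 * s)) := by
    rw [← scale_rpow L hL0 _ _ hpos]
    refine mul_le_mul_right ?_ _
    rw [ENNReal.rpow_neg, ENNReal.rpow_neg]
    apply ENNReal.inv_le_inv.2
    apply ENNReal.rpow_le_rpow _ hpos
    rw [← ENNReal.coe_mul, ENNReal.coe_le_coe]
    simpa [nndist_eq_nnnorm] using hL.nndist_le y x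
  have hG : Measurable (fun p : E2 × E2 =>
    (‖u p.2 - u p.1‖₊ : ℝ≥0∞) ^ (2 : ℝ) * (‖p.2 - p.1‖₊ : ℝ≥0∞) ^ (-(2 + 2 * s))) := by
    fun_prop
  have hG1 (x : E2) : Measurable (fun y : E2 =>
    (‖u y - u x‖₊ : ℝ≥0∞) ^ (2 : ℝ) * (‖y - x‖₊ : ℝ≥0∞) ^ (-(2 + 2 * s))) := by
    fun_prop
  calc gag s (u ∘ Φ) ≤ ∫⁻ x : E2, ∫⁻ y : E2, (L : ℝ≥0∞) ^ (2 + 2 * s) *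
        ((‖u (Φ y) - u (Φ x)‖₊ : ℝ≥0∞) ^ (2 : ℝ) * (‖Φ y - Φ x‖₊ : ℝ≥0∞) ^ (-(2 + 2 * s))) := by
        unfold gag
        refine lintegral_mono fun x => lintegral_mono fun y => ?_
        rw [mul_left_comm]
        exact mul_le_mul_right (key x y) _
    _ = ∫⁻ x : E2, (L : ℝ≥0∞) ^ (2 + 2 * s) * ∫⁻ y : E2,
        ((‖u y - u (Φ x)‖₊ : ℝ≥0∞) ^ (2 : ℝ) * (‖y - Φ x‖₊ : ℝ≥0∞) ^ (-(2 + 2 * s))) := by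
        congr 1 with x
        rw [lintegral_const_mul _ (by fun_prop), hΦ.lintegral_comp (hG1 (Φ x))]
    _ = (L : ℝ≥0∞) ^ (2 + 2 * s) * ∫⁻ x : E2, ∫⁻ y : E2,
        ((‖u y - u (Φ x)‖₊ : ℝ≥0∞) ^ (2 : ℝ) * (‖y - Φ x‖₊ : ℝ≥0∞) ^ (-(2 + 2 * s))) := by
        rw [lintegral_const_mul]
        exact (hG.lintegral_prod_right').comp hc
    _ = _ := by
        rw [hΦ.lintegral_comp hG.lintegral_prod_right', gag]

end Aux

/-- **Composition estimate in `Ḣˢ`, `0 < s < 1` (Lemma A.1 (iii)).**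
Let `Φ(y) = y + Ψ(y)` be a diffeomorphism of `ℝ²` with `det (I + ∇Ψ) = 1`.
Then for `0 < s < 1` and any `u ∈ Ḣˢ(ℝ²)`,
`‖u ∘ Φ‖_{Ḣˢ} ≲ (1 + ‖∇Ψ‖_{L^∞})^{s+1} ‖u‖_{Ḣˢ}`. -/
theorem comp_diffeo_hs (s : ℝ) (hs0 : 0 < s) (hs1 : s < 1) :
    ∃ C : ℝ≥0∞, C ≠ ⊤ ∧
      ∀ (Ψ : E2 → E2) (M : ℝ), 0 ≤ M →
        ContDiff ℝ 1 (fun y => y + Ψ y) →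
        Function.Bijective (fun y => y + Ψ y) →
        ContDiff ℝ 1 (Function.invFun (fun y => y + Ψ y)) →
        (∀ y : E2, (fderiv ℝ (fun y => y + Ψ y) y).det = 1) →
        (∀ y : E2, ‖fderiv ℝ Ψ y‖ ≤ M) →
        ∀ u : E2 → ℂ, hsNorm s u ≠ ⊤ →
          hsNorm s (fun y => u (y + Ψ y)) ≤
            C * ENNReal.ofReal ((1 + M) ^ (s + 1)) * hsNorm s u := by
  refine ⟨1, one_ne_top, ?_⟩
  intro Ψ M hM hcd hbij _ hdet hΨ u _
  rw [one_mul]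
  set Φ : E2 → E2 := fun y => y + Ψ y with hΦdef
  change hsNorm s (u ∘ Φ) ≤ _
  have hdiff : Differentiable ℝ Φ := hcd.differentiable (by norm_num)
  have hemb : MeasurableEmbedding Φ := hcd.continuous.measurableEmbedding hbij.1
  have hmp : MeasurePreserving Φ := by
    refine ⟨hemb.measurable, ?_⟩
    ext A hA
    rw [hemb.map_apply]
    have := lintegral_image_eq_lintegral_abs_det_fderiv_mul (volume : Measure E2)
      (s := Set.univ) (f := Φ) (f' := fderiv ℝ Φ) MeasurableSet.univ
      (fun x _ => (hdiff x).hasFDerivAt.hasFDerivWithinAt) hbij.1.injOn (A.indicator 1)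
    rw [Set.image_univ, hbij.2.range_eq] at this
    simp only [hdet, Measure.restrict_univ, abs_one, ENNReal.ofReal_one, one_mul] at this
    rw [lintegral_indicator_one hA] at this
    rw [this, ← lintegral_indicator_one (hemb.measurable hA)]
    rfl
  have hLip : LipschitzWith (Real.toNNReal (1 + M)) Φ := by
    apply lipschitzWith_of_nnnorm_fderiv_le hdiff
    intro x
    have hΨd : DifferentiableAt ℝ Ψ x := by
      have : Ψ = fun y => Φ y - y := by ext1 y; simp [hΦdef]
      rw [this]
      exact (hdiff x).sub differentiableAt_id
    rw [← NNReal.coe_le_coe, coe_nnnorm, Real.coe_toNNReal _ (by linarith)]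
    rw [hΦdef, fderiv_fun_add differentiableAt_fun_id hΨd]
    refine (norm_add_le _ _).trans (add_le_add ?_ (hΨ x))
    rw [fderiv_fun_id]
    exact ContinuousLinearMap.norm_id_le
  by_cases hu : Integrable u
  swap
  · have hu' : ¬ Integrable (u ∘ Φ) := by rwa [hmp.integrable_comp_emb hemb]
    have : hsNorm s (u ∘ Φ) = 0 := by
      have : 𝓕 (u ∘ Φ) = 0 := by
        ext ξ
        rw [Real.fourier_eq]
        apply integral_undef
        rwa [Real.fourierIntegral_convergent_iff ξ]
      simp [hsNorm, this]
    rw [this]; exact zero_le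
  -- measurable representative
  obtain ⟨v, hvm, huv⟩ := hu.1
  have hvm := hvm.measurable
  have hv : Integrable v := hu.congr huv
  have hcomp : u ∘ Φ =ᵐ[volume] v ∘ Φ := hmp.quasiMeasurePreserving.ae_eq_comp huv
  have hFeq {f g : E2 → ℂ} (h : f =ᵐ[volume] g) : 𝓕 f = 𝓕 g := by
    ext ξ
    rw [Real.fourier_eq, Real.fourier_eq]
    apply integral_congr_ae
    filter_upwards [h] with x hx
    rw [hx]
  have e1 : hsNorm s (u ∘ Φ) = hsNorm s (v ∘ Φ) := by rw [hsNorm, hFeq hcomp, hsNorm]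
  have e2 : hsNorm s u = hsNorm s v := by rw [hsNorm, hFeq huv, hsNorm]
  rw [e1, e2]
  have hvΦ : Integrable (v ∘ Φ) := (hmp.integrable_comp_emb hemb).2 hv
  obtain ⟨e, he⟩ := exists_norm_eq E2 (zero_le_one' ℝ)
  have h1 := gag_comp_le s hs0 Φ _ hLip (by simp; linarith) hmp v hvm
  rw [gag_eq s hs0 e he hvm hv, gag_eq s hs0 e he (hvm.comp hemb.measurable) hvΦ,
    mul_left_comm, ENNReal.mul_le_mul_iff_right (gag_pos s e he) (gag_fin s hs0 hs1 e he)] at h1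
  unfold hsNorm
  calc _ ≤ _ := ENNReal.rpow_le_rpow h1 (by norm_num : (0:ℝ) ≤ 1 / 2)
    _ = _ := by
      rw [ENNReal.mul_rpow_of_nonneg _ _ (by norm_num), ← ENNReal.rpow_mul,
        show (2 + 2 * s) * (1 / 2) = s + 1 by ring,
        ← ENNReal.ofReal_rpow_of_nonneg (by linarith) (by linarith)]
      rfl
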